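/- arXiv:1502.05003 — 3 statements merged into one kernel-verified Lean document; each statement's English description precedes it below -/
import Mathlib

section
/- Let $X_1,\ldots,X_n$ be (not necessarily independent) real random variables and let $C_0>0$ and $\sigma_1,\ldots,\sigma_n \ge 0$ satisfy $\P[X_i > x] \le C_0 e^{-x^2/(C_0\sigma_i^2)}$ for all $x\ge 0$ and all $i$. Then there is a constant $C$ depending only on $C_0$ such that $\mathbf{E}[\max_{i\le n} X_i] \le C \max_{i\le n} \sigma_i^* \sqrt{\log(i+1)}$, where $\sigma_1^*\ge\sigma_2^*\ge\cdots\ge\sigma_n^*$ is the decreasing rearrangement of $\sigma_1,\ldots,\sigma_n$. -/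
open MeasureTheory ProbabilityTheory Real

/-- A random variable with exponential tails at scale `M` has expectation at most of order `M`. -/
theorem integral_le_of_exp_tail {Ω : Type*} [MeasurableSpace Ω] {μ : Measure Ω}
    {Z : Ω → ℝ} (hZ : Measurable Z) {M A : ℝ} (hM : 0 ≤ M) (hA : 0 ≤ A)
    (h : ∀ t : ℝ, 0 ≤ t → μ {ω | M * t < Z ω} ≤ ENNReal.ofReal (A * Real.exp (-t))) :
    ∫ ω, Z ω ∂μ ≤ A * M := by
  rcases hM.eq_or_lt with rfl | hM
  · have h0 : μ {ω | 0 < Z ω} = 0 := by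
      have hlim : Filter.Tendsto (fun t : ℝ => ENNReal.ofReal (A * Real.exp (-t)))
          Filter.atTop (nhds 0) := by
        have := ENNReal.tendsto_ofReal (Real.tendsto_exp_neg_atTop_nhds_zero.const_mul A)
        simpa using this
      refine le_antisymm (ge_of_tendsto hlim ?_) zero_le
      filter_upwards [Filter.eventually_ge_atTop 0] with t ht
      simpa using h t ht
    rw [mul_zero]
    refine integral_nonpos_of_ae ?_
    have : ∀ᵐ ω ∂μ, ¬ 0 < Z ω := by
      rw [ae_iff]; simpa using h0
    filter_upwards [this] with ω hω using not_lt.1 hω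
  · by_cases hint : Integrable Z μ
    swap
    · rw [integral_undef hint]; positivity
    have hnonneg : 0 ≤ᵐ[μ] fun ω => max (Z ω / M) 0 :=
      Filter.Eventually.of_forall fun ω => le_max_right _ _
    have hmeas : Measurable fun ω => max (Z ω / M) 0 := (hZ.div_const M).max measurable_const
    have key : ∫⁻ ω, ENNReal.ofReal (max (Z ω / M) 0) ∂μ ≤ ENNReal.ofReal A := by
      rw [lintegral_eq_lintegral_meas_lt μ hnonneg hmeas.aemeasurable]
      calc ∫⁻ t in Set.Ioi (0 : ℝ), μ {ω | t < max (Z ω / M) 0}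
          ≤ ∫⁻ t in Set.Ioi (0 : ℝ), ENNReal.ofReal (A * Real.exp (-t)) := by
            refine setLIntegral_mono (by fun_prop) fun t ht => ?_
            refine (measure_mono fun ω hω => ?_).trans (h t (le_of_lt ht))
            rcases lt_max_iff.1 (Set.mem_ofPred_eq ▸ hω) with hω | hω
            · rw [lt_div_iff₀ hM] at hω
              simpa [mul_comm] using hω
            · exact absurd hω (not_lt.2 (le_of_lt ht))
        _ = ENNReal.ofReal A := by
            rw [← ofReal_integral_eq_lintegral_ofReal
              ((integrableOn_exp_neg_Ioi 0).const_mul A)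
              (Filter.Eventually.of_forall fun t => by positivity),
              integral_const_mul, integral_exp_neg_Ioi_zero, mul_one]
    have hle : ∫ ω, max (Z ω / M) 0 ∂μ ≤ A := by
      rw [integral_eq_lintegral_of_nonneg_ae hnonneg hmeas.aestronglyMeasurable]
      exact ENNReal.toReal_le_of_le_ofReal hA key
    have hle' : ∫ ω, Z ω / M ∂μ ≤ ∫ ω, max (Z ω / M) 0 ∂μ :=
      integral_mono (hint.div_const M) (hint.div_const M).pos_part fun ω => le_max_left _ _
    rw [integral_div, div_le_iff₀ hM] at hle'
    exact hle'.trans (mul_le_mul_of_nonneg_right hle hM.le)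

theorem summable_one_div_nat_add_two_sq :
    Summable fun i : ℕ => 1 / ((i : ℝ) + 2) ^ 2 := by
  have := (summable_nat_add_iff 2).2 (Real.summable_one_div_nat_pow.2 one_lt_two)
  simpa using this

theorem half_le_log_nat_add_two (i : ℕ) : 1 / 2 ≤ Real.log ((i : ℝ) + 2) := by
  have h2 : Real.log 2 ≤ Real.log ((i : ℝ) + 2) :=
    Real.log_le_log two_pos (by linarith [i.cast_nonneg (α := ℝ)])
  linarith [Real.log_two_gt_d9]

/-- For large `t`, the Gaussian tail at `t * √(log (i + 2))` is summable in `i` and decays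
exponentially in `t`. -/
theorem exp_neg_sq_mul_sqrt_log_le {c t : ℝ} (hc : 0 < c) (ht : 2 * c + 2 ≤ t) (i : ℕ) :
    Real.exp (-((t * √(Real.log (i + 2))) ^ 2) / c)
      ≤ 1 / ((i : ℝ) + 2) ^ 2 * Real.exp (1 - t) := by
  have hL := half_le_log_nat_add_two i
  have hpos : (0 : ℝ) < (i : ℝ) + 2 := by positivity
  have hsq : 1 / ((i : ℝ) + 2) ^ 2 = Real.exp (-(2 * Real.log (i + 2))) := by
    rw [Real.exp_neg, two_mul, Real.exp_add, Real.exp_log hpos, one_div, sq]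
  rw [hsq, ← Real.exp_add, mul_pow, Real.sq_sqrt (by linarith)]
  refine Real.exp_le_exp.2 ?_
  have ha : 2 * t ≤ t ^ 2 / c := by
    rw [le_div_iff₀ hc]; nlinarith
  have hrw : -(t ^ 2 * Real.log (i + 2)) / c = -(t ^ 2 / c * Real.log (i + 2)) := by ring
  rw [hrw]
  nlinarith [mul_nonneg (by linarith : 0 ≤ t ^ 2 / c - 2) (sub_nonneg.2 hL)]

/-- The tail condition `ℙ[Xᵢ > x] ≤ C₀ exp(-x²/(C₀σᵢ²))` for all `x ≥ 0` is stated in the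
equivalent substituted form `ℙ[Xᵢ > σᵢ x] ≤ C₀ exp(-x²/C₀)` for all `x ≥ 0` (this avoids the
division-by-zero convention when `σᵢ = 0`).  `τ` is a permutation sorting `σ` in nonincreasing
order, so `σ (τ i)` is the decreasing rearrangement `σᵢ*`; indices are 1-based in the paper,
so `√(log (i+1))` becomes `√(log (i.1 + 2))`. -/
theorem stmt7 (C₀ : ℝ) (hC₀ : 0 < C₀) :
    ∃ C : ℝ, 0 < C ∧
      ∀ (Ω : Type*) [MeasureSpace Ω] [IsProbabilityMeasure (ℙ : Measure Ω)]
        (n : ℕ) (X : Fin n → Ω → ℝ) (σ : Fin n → ℝ),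
        (∀ i, 0 ≤ σ i) → (∀ i, Measurable (X i)) →
        (∀ i, ∀ x : ℝ, 0 ≤ x →
          ℙ {ω | σ i * x < X i ω} ≤ ENNReal.ofReal (C₀ * Real.exp (-(x ^ 2) / C₀))) →
        ∀ (τ : Equiv.Perm (Fin n)), Antitone (σ ∘ τ) →
        ∫ ω, (⨆ i, X i ω)
          ≤ C * ⨆ i : Fin n, σ (τ i) * Real.sqrt (Real.log (i.1 + 2)) := by
  set S : ℝ := ∑' i : ℕ, 1 / ((i : ℝ) + 2) ^ 2
  have hS : 0 ≤ S := tsum_nonneg fun i => by positivity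
  refine ⟨Real.exp (2 * C₀ + 2) + C₀ * S * Real.exp 1, by positivity, ?_⟩
  intro Ω _ _ n X σ hσ hX htail τ _
  rcases isEmpty_or_nonempty (Fin n) with hn | hn
  · simp
  set M : ℝ := ⨆ i : Fin n, σ (τ i) * √(Real.log (i.1 + 2))
  have hM : 0 ≤ M := Real.iSup_nonneg fun i => mul_nonneg (hσ _) (Real.sqrt_nonneg _)
  refine integral_le_of_exp_tail (Measurable.iSup hX) hM (by positivity) fun t ht => ?_
  rcases le_total t (2 * C₀ + 2) with hle | hle
  · refine prob_le_one.trans ?_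
    rw [← ENNReal.ofReal_one]
    refine ENNReal.ofReal_le_ofReal ?_
    rw [add_mul, ← Real.exp_add]
    have h1 : 1 ≤ Real.exp (2 * C₀ + 2 + -t) := Real.one_le_exp (by linarith)
    have h2 : 0 ≤ C₀ * S * Real.exp 1 * Real.exp (-t) := by positivity
    linarith
  · have hsub : {ω | M * t < ⨆ i, X i ω} ⊆
        ⋃ i : Fin n, {ω | σ (τ i) * (t * √(Real.log (i.1 + 2))) < X (τ i) ω} := by
      intro ω hω
      obtain ⟨j, hj⟩ := exists_lt_of_lt_ciSup (Set.mem_ofPred_eq ▸ hω)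
      obtain ⟨i, rfl⟩ := τ.surjective j
      refine Set.mem_iUnion.2 ⟨i, lt_of_le_of_lt ?_ hj⟩
      have hi : σ (τ i) * √(Real.log (i.1 + 2)) ≤ M :=
        le_ciSup (f := fun i : Fin n => σ (τ i) * √(Real.log (i.1 + 2)))
          (Set.finite_range _).bddAbove i
      calc σ (τ i) * (t * √(Real.log (i.1 + 2)))
          = σ (τ i) * √(Real.log (i.1 + 2)) * t := by ring
        _ ≤ M * t := mul_le_mul_of_nonneg_right hi ht
    have hsum : ∑ i : Fin n, 1 / ((i.1 : ℝ) + 2) ^ 2 ≤ S := by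
      rw [Fin.sum_univ_eq_sum_range (fun i : ℕ => 1 / ((i : ℝ) + 2) ^ 2)]
      exact summable_one_div_nat_add_two_sq.sum_le_tsum _ fun i _ => by positivity
    calc ℙ {ω | M * t < ⨆ i, X i ω}
        ≤ ∑ i : Fin n, ℙ {ω | σ (τ i) * (t * √(Real.log (i.1 + 2))) < X (τ i) ω} :=
          (measure_mono hsub).trans (measure_iUnion_fintype_le _ _)
      _ ≤ ∑ i : Fin n,
            ENNReal.ofReal (C₀ * (1 / ((i.1 : ℝ) + 2) ^ 2 * Real.exp (1 - t))) := by
          refine Finset.sum_le_sum fun i _ => (htail (τ i) _ (by positivity)).trans ?_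
          exact ENNReal.ofReal_le_ofReal
            (mul_le_mul_of_nonneg_left (exp_neg_sq_mul_sqrt_log_le hC₀ hle i) hC₀.le)
      _ = ENNReal.ofReal
            (C₀ * ((∑ i : Fin n, 1 / ((i.1 : ℝ) + 2) ^ 2) * Real.exp (1 - t))) := by
          rw [← ENNReal.ofReal_sum_of_nonneg fun i _ => by positivity, ← Finset.mul_sum,
            ← Finset.sum_mul]
      _ ≤ _ := by
          refine ENNReal.ofReal_le_ofReal ?_
          have h1 : C₀ * ((∑ i : Fin n, 1 / ((i.1 : ℝ) + 2) ^ 2) * Real.exp (1 - t))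
              ≤ C₀ * (S * Real.exp (1 - t)) := by gcongr
          have h2 : 0 ≤ Real.exp (2 * C₀ + 2) * Real.exp (-t) := by positivity
          rw [sub_eq_add_neg, Real.exp_add] at h1 ⊢
          linarith
end

section
/- Let $\{b_{ij}\}$ be nonnegative scalars with $b_{ij}=b_{ji}$, define for $v\in\mathbb{R}^d$ the quantities $\|v\|_i^2 := \sum_j b_{ij}^2 v_j^2$ and $x_i(v):=v_i\|v\|_i$, and let $d(v,w)^2 := \sum_{ij}(v_i+w_i)^2 b_{ij}^2 (v_j-w_j)^2 + \sum_{i\ne j}(v_i^2-w_i^2)b_{ij}^2(v_j^2-w_j^2)$ be the natural distance of the Gaussian process $\langle v, Xv\rangle$. Then for every $v,w\in\mathbb{R}^d$ and every $\gamma>0$: $d(v,w)^2 \le (2+\gamma+\gamma^{-1})\|x(v)-x(w)\|^2 - \gamma\sum_{ij}(v_i^2-w_i^2)b_{ij}^2(v_j^2-w_j^2)$, where $\|x(v)-x(w)\|$ is the Euclidean norm of the vector with components $x_i(v)-x_i(w)$. -/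
open Real

/-- Minkowski's inequality for a weighted Euclidean seminorm. -/
lemma weighted_sum_add_sq_le {ι : Type*} [Fintype ι] (c v w : ι → ℝ) :
    ∑ j, (c j) ^ 2 * (v j + w j) ^ 2 ≤
      (Real.sqrt (∑ j, (c j) ^ 2 * (v j) ^ 2) +
        Real.sqrt (∑ j, (c j) ^ 2 * (w j) ^ 2)) ^ 2 := by
  have hcs := Real.sum_mul_le_sqrt_mul_sqrt Finset.univ
    (fun j => c j * v j) (fun j => c j * w j)
  simp only [mul_pow] at hcs
  have hv : 0 ≤ ∑ j, (c j) ^ 2 * (v j) ^ 2 := Finset.sum_nonneg fun j _ => by positivity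
  have hw : 0 ≤ ∑ j, (c j) ^ 2 * (w j) ^ 2 := Finset.sum_nonneg fun j _ => by positivity
  have hexp : ∑ j, (c j) ^ 2 * (v j + w j) ^ 2 =
      ∑ j, (c j) ^ 2 * (v j) ^ 2 + 2 * ∑ j, c j * v j * (c j * w j) +
        ∑ j, (c j) ^ 2 * (w j) ^ 2 := by
    rw [Finset.mul_sum, ← Finset.sum_add_distrib, ← Finset.sum_add_distrib]
    exact Finset.sum_congr rfl fun j _ => by ring
  rw [hexp, add_sq, Real.sq_sqrt hv, Real.sq_sqrt hw]
  linarith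

/-- With `p = (x + y) * (s - t)` and `q = (x - y) * (s + t)`, so that
`x * s - y * t = (p + q) / 2`, the difference of the two sides is
`((1 + γ) * p + (1 - γ) * q) ^ 2 / (4 * γ)`. -/
lemma sq_add_mul_le_mul_sub_sq (x y s t γ : ℝ) (hγ : 0 < γ) :
    (x - y) ^ 2 * (s + t) ^ 2 + (1 + γ) * ((x ^ 2 - y ^ 2) * (s ^ 2 - t ^ 2)) ≤
      (2 + γ + γ⁻¹) * (x * s - y * t) ^ 2 := by
  have h : (2 + γ + γ⁻¹) * (x * s - y * t) ^ 2 -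
      ((x - y) ^ 2 * (s + t) ^ 2 + (1 + γ) * ((x ^ 2 - y ^ 2) * (s ^ 2 - t ^ 2))) =
      ((1 + γ) * ((x + y) * (s - t)) + (1 - γ) * ((x - y) * (s + t))) ^ 2 / (4 * γ) := by
    field_simp
    ring
  have : 0 ≤ ((1 + γ) * ((x + y) * (s - t)) + (1 - γ) * ((x - y) * (s + t))) ^ 2 / (4 * γ) := by
    positivity
  linarith

theorem stmt17 {d : ℕ} (b : Fin d → Fin d → ℝ)
    (hb : ∀ i j, 0 ≤ b i j) (hbs : ∀ i j, b i j = b j i)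
    (v w : Fin d → ℝ) (γ : ℝ) (hγ : 0 < γ) :
    (∑ i, ∑ j, (v i + w i) ^ 2 * (b i j) ^ 2 * (v j - w j) ^ 2) +
        (∑ i, ∑ j, if j ≠ i then
          ((v i) ^ 2 - (w i) ^ 2) * (b i j) ^ 2 * ((v j) ^ 2 - (w j) ^ 2) else 0)
      ≤ (2 + γ + γ⁻¹) *
            (∑ i, (v i * Real.sqrt (∑ j, (b i j) ^ 2 * (v j) ^ 2) -
                   w i * Real.sqrt (∑ j, (b i j) ^ 2 * (w j) ^ 2)) ^ 2) -
          γ * ∑ i, ∑ j,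
            ((v i) ^ 2 - (w i) ^ 2) * (b i j) ^ 2 * ((v j) ^ 2 - (w j) ^ 2) := by
  have hoff : (∑ i, ∑ j, if j ≠ i then
          ((v i) ^ 2 - (w i) ^ 2) * (b i j) ^ 2 * ((v j) ^ 2 - (w j) ^ 2) else 0) ≤
      ∑ i, ∑ j, ((v i) ^ 2 - (w i) ^ 2) * (b i j) ^ 2 * ((v j) ^ 2 - (w j) ^ 2) := by
    refine Finset.sum_le_sum fun i _ => Finset.sum_le_sum fun j _ => ?_
    split_ifs with h
    · exact le_rfl
    · obtain rfl : j = i := not_not.mp h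
      nlinarith [sq_nonneg (b j j * ((v j) ^ 2 - (w j) ^ 2))]
  have hswap : ∑ i, ∑ j, (v i + w i) ^ 2 * (b i j) ^ 2 * (v j - w j) ^ 2 =
      ∑ i, (v i - w i) ^ 2 * ∑ j, (b i j) ^ 2 * (v j + w j) ^ 2 := by
    rw [Finset.sum_comm]
    refine Finset.sum_congr rfl fun i _ => ?_
    rw [Finset.mul_sum]
    refine Finset.sum_congr rfl fun j _ => ?_
    rw [hbs j i]
    ring
  have hcross : ∑ i, ∑ j, ((v i) ^ 2 - (w i) ^ 2) * (b i j) ^ 2 * ((v j) ^ 2 - (w j) ^ 2) =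
      ∑ i, ((v i) ^ 2 - (w i) ^ 2) * (Real.sqrt (∑ j, (b i j) ^ 2 * (v j) ^ 2) ^ 2 -
        Real.sqrt (∑ j, (b i j) ^ 2 * (w j) ^ 2) ^ 2) := by
    refine Finset.sum_congr rfl fun i _ => ?_
    rw [Real.sq_sqrt (Finset.sum_nonneg fun j _ => by positivity),
      Real.sq_sqrt (Finset.sum_nonneg fun j _ => by positivity),
      ← Finset.sum_sub_distrib, Finset.mul_sum]
    exact Finset.sum_congr rfl fun j _ => by ring
  have hmain : ∑ i, (v i - w i) ^ 2 * ∑ j, (b i j) ^ 2 * (v j + w j) ^ 2 +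
      (1 + γ) * ∑ i, ((v i) ^ 2 - (w i) ^ 2) *
        (Real.sqrt (∑ j, (b i j) ^ 2 * (v j) ^ 2) ^ 2 -
          Real.sqrt (∑ j, (b i j) ^ 2 * (w j) ^ 2) ^ 2) ≤
      (2 + γ + γ⁻¹) * ∑ i, (v i * Real.sqrt (∑ j, (b i j) ^ 2 * (v j) ^ 2) -
        w i * Real.sqrt (∑ j, (b i j) ^ 2 * (w j) ^ 2)) ^ 2 := by
    rw [Finset.mul_sum, Finset.mul_sum, ← Finset.sum_add_distrib]
    refine Finset.sum_le_sum fun i _ => le_trans ?_ (sq_add_mul_le_mul_sub_sq _ _ _ _ γ hγ)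
    gcongr
    exact weighted_sum_add_sq_le (b i) v w
  rw [← hswap, ← hcross] at hmain
  linarith
end

section
/- Let $\{b_{ij}\}$ be nonnegative scalars with $b_{ij}=b_{ji}$, and define $x_i(v):= v_i(\sum_j b_{ij}^2 v_j^2)^{1/2}$ for $v\in\mathbb{R}^d$. Then for any $g\in\mathbb{R}^d$ and any $v$ in the Euclidean unit ball $B_2$ of $\mathbb{R}^d$: $\sum_i x_i(v) g_i \le \max_i (\sum_j b_{ij}^2 g_j^2)^{1/2}$. Equivalently, $\sup_{v\in B_2}\langle x(v),g\rangle \le \max_i(\sum_j b_{ij}^2 g_j^2)^{1/2}$. -/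
open Real

theorem stmt19 {d : ℕ} (b : Fin d → Fin d → ℝ)
    (hb : ∀ i j, 0 ≤ b i j) (hbs : ∀ i j, b i j = b j i)
    (g : Fin d → ℝ) (v : Fin d → ℝ) (hv : ∑ i, (v i) ^ 2 ≤ 1) :
    ∑ i, (v i * Real.sqrt (∑ j, (b i j) ^ 2 * (v j) ^ 2)) * g i
      ≤ ⨆ i, Real.sqrt (∑ j, (b i j) ^ 2 * (g j) ^ 2) := by
  set M : ℝ := ⨆ i, Real.sqrt (∑ j, (b i j) ^ 2 * (g j) ^ 2)
  have hM_nonneg : 0 ≤ M := Real.iSup_nonneg fun i => Real.sqrt_nonneg _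
  have hle_M (i : Fin d) : ∑ j, (b i j) ^ 2 * (g j) ^ 2 ≤ M ^ 2 :=
    (Real.sqrt_le_left hM_nonneg).1 <|
      le_ciSup (f := fun i => Real.sqrt (∑ j, (b i j) ^ 2 * (g j) ^ 2))
        (Set.finite_range _).bddAbove i
  have hsum : ∑ i, (Real.sqrt (∑ j, (b i j) ^ 2 * (v j) ^ 2) * g i) ^ 2 ≤ M ^ 2 := by
    calc ∑ i, (Real.sqrt (∑ j, (b i j) ^ 2 * (v j) ^ 2) * g i) ^ 2
        = ∑ i, ∑ j, (b i j) ^ 2 * (v j) ^ 2 * (g i) ^ 2 := by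
          refine Finset.sum_congr rfl fun i _ => ?_
          rw [mul_pow, Real.sq_sqrt (by positivity), Finset.sum_mul]
      _ = ∑ j, (v j) ^ 2 * ∑ i, (b j i) ^ 2 * (g i) ^ 2 := by
          rw [Finset.sum_comm]
          refine Finset.sum_congr rfl fun j _ => ?_
          rw [Finset.mul_sum]
          refine Finset.sum_congr rfl fun i _ => ?_
          rw [hbs i j]
          ring
      _ ≤ ∑ j, (v j) ^ 2 * M ^ 2 :=
          Finset.sum_le_sum fun j _ => mul_le_mul_of_nonneg_left (hle_M j) (sq_nonneg _)
      _ = (∑ j, (v j) ^ 2) * M ^ 2 := (Finset.sum_mul _ _ _).symm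
      _ ≤ M ^ 2 := mul_le_of_le_one_left (sq_nonneg M) hv
  refine le_of_abs_le (abs_le_of_sq_le_sq ?_ hM_nonneg)
  simp only [mul_assoc]
  calc (∑ i, v i * (Real.sqrt (∑ j, (b i j) ^ 2 * (v j) ^ 2) * g i)) ^ 2
      ≤ (∑ i, (v i) ^ 2) * ∑ i, (Real.sqrt (∑ j, (b i j) ^ 2 * (v j) ^ 2) * g i) ^ 2 :=
        Finset.sum_mul_sq_le_sq_mul_sq _ _ _
    _ ≤ 1 * M ^ 2 := mul_le_mul hv hsum (by positivity) zero_le_one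
    _ = M ^ 2 := one_mul _
end
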